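/- arXiv:0802.4183 — 3 statements merged into one kernel-verified Lean document; each statement's English description precedes it below -/
import Mathlib

section
/- The Lebesgue volume of the Gelfand–Cetlin polytope GC_a(λ) with top row λ ∈ ℝ^n satisfying λ₁ > λ₂ > ... > λ_n equals ∏_{1≤i<j≤n} (λ_i − λ_j) / ∏_{k=1}^{n-1} k!. -/
open MeasureTheory

/-- `u ⪰ v` : for `u ∈ ℝ^p`, `v ∈ ℝ^q` with `p = q` or `p = q + 1`, the
interlacing relation `u₁ ≥ v₁ ≥ u₂ ≥ v₂ ≥ ...`. -/
def Interlaced {p q : ℕ} (u : Fin p → ℝ) (v : Fin q → ℝ) : Prop :=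
  (∀ j : Fin q, ∀ h : (j : ℕ) < p, u ⟨j, h⟩ ≥ v j) ∧
  (∀ j : Fin q, ∀ h : (j : ℕ) + 1 < p, v j ≥ u ⟨(j : ℕ) + 1, h⟩)

namespace GelfandCetlin

/-- The Vandermonde product of `u` divided by the superfactorial. -/
noncomputable def normalizedVandermonde {p : ℕ} (u : Fin p → ℝ) : ℝ :=
  (∏ q ∈ Finset.univ.filter fun q : Fin p × Fin p => q.1 < q.2, (u q.1 - u q.2)) /
    ∏ k ∈ Finset.range p, (Nat.factorial k : ℝ)

/-- The polynomial `(-t) ^ k / k!`. -/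
noncomputable def negMonomial (k : ℕ) (t : ℝ) : ℝ := (-t) ^ k / (Nat.factorial k : ℝ)

lemma continuous_negMonomial (k : ℕ) : Continuous (negMonomial k) := by
  unfold negMonomial
  fun_prop

lemma hasDerivAt_negMonomial_succ (k : ℕ) (t : ℝ) :
    HasDerivAt (negMonomial (k + 1)) (-negMonomial k t) t := by
  have h := ((hasDerivAt_id t).neg.pow (k + 1)).div_const (Nat.factorial (k + 1) : ℝ)
  refine h.congr_deriv ?_
  have h1 : (Nat.factorial k : ℝ) ≠ 0 := by positivity
  have h2 : (k : ℝ) + 1 ≠ 0 := by positivity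
  simp only [negMonomial, Nat.factorial_succ, Nat.cast_mul, Nat.cast_add, Nat.cast_one,
    Nat.add_sub_cancel, Pi.neg_apply, id]
  field_simp

lemma integral_negMonomial (k : ℕ) {a b : ℝ} (hab : a ≤ b) :
    ∫ t in Set.Icc a b, negMonomial k t = negMonomial (k + 1) a - negMonomial (k + 1) b := by
  rw [integral_Icc_eq_integral_Ioc, ← intervalIntegral.integral_of_le hab,
    intervalIntegral.integral_eq_sub_of_hasDerivAt
      (f := fun t => -negMonomial (k + 1) t) (fun t _ => ?_)
      ((continuous_negMonomial k).intervalIntegrable a b)]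
  · ring
  · simpa using (hasDerivAt_negMonomial_succ k t).fun_neg

lemma normalizedVandermonde_eq_det {p : ℕ} (u : Fin p → ℝ) :
    normalizedVandermonde u = (Matrix.of fun i j : Fin p => negMonomial j (u i)).det := by
  have h : (Matrix.of fun i j : Fin p => negMonomial j (u i)) =
      Matrix.of fun i j : Fin p =>
        (Nat.factorial j : ℝ)⁻¹ * Matrix.vandermonde (fun i => -u i) i j := by
    ext i j
    simp [negMonomial, Matrix.vandermonde_apply, div_eq_inv_mul]
  rw [h, Matrix.det_mul_row, Matrix.det_vandermonde, normalizedVandermonde, div_eq_inv_mul,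
    Finset.prod_range, Finset.prod_inv_distrib]
  congr 1
  rw [Finset.prod_filter, ← Finset.univ_product_univ, Finset.prod_product]
  refine Finset.prod_congr rfl fun i _ => ?_
  rw [← Finset.prod_filter]
  refine Finset.prod_congr (by ext; simp) fun j _ => by ring

lemma normalizedVandermonde_nonneg {p : ℕ} {u : Fin p → ℝ} (hu : Antitone u) :
    0 ≤ normalizedVandermonde u := by
  refine div_nonneg (Finset.prod_nonneg fun q hq => ?_) (by positivity)
  exact sub_nonneg.2 (hu (Finset.mem_filter.1 hq).2.le)

lemma integrable_det {ι : Type*} [Fintype ι] [DecidableEq ι] {μ : ι → Measure ℝ}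
    [∀ i, SigmaFinite (μ i)] {g : ι → ℝ → ℝ} (hg : ∀ i j, Integrable (g j) (μ i)) :
    Integrable (fun x : ι → ℝ => (Matrix.of fun i j => g j (x i)).det) (Measure.pi μ) := by
  simp_rw [← Matrix.det_transpose (Matrix.of fun i j => g j _), Matrix.det_apply']
  exact integrable_finsetSum _ fun σ _ =>
    (Integrable.fintype_prod (f := fun i => g (σ i)) fun i => hg i (σ i)).const_mul _

lemma integral_det {ι : Type*} [Fintype ι] [DecidableEq ι] {μ : ι → Measure ℝ}
    [∀ i, SigmaFinite (μ i)] {g : ι → ℝ → ℝ} (hg : ∀ i j, Integrable (g j) (μ i)) :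
    ∫ x, (Matrix.of fun i j => g j (x i)).det ∂(Measure.pi μ) =
      (Matrix.of fun i j => ∫ t, g j t ∂(μ i)).det := by
  simp_rw [← Matrix.det_transpose (Matrix.of fun i j => g j _),
    ← Matrix.det_transpose (Matrix.of fun i j => ∫ t, g j t ∂(μ i)), Matrix.det_apply']
  rw [integral_finsetSum _ fun σ _ =>
    (Integrable.fintype_prod (f := fun i => g (σ i)) fun i => hg i (σ i)).const_mul _]
  refine Finset.sum_congr rfl fun σ _ => ?_
  rw [integral_const_mul]
  congr 1
  exact integral_fintype_prod_eq_prod (𝕜 := ℝ) (μ := μ) fun i => g (σ i)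

lemma normalizedVandermonde_eq_det_sub {k : ℕ} (u : Fin (k + 1) → ℝ) :
    normalizedVandermonde u = (Matrix.of fun i j : Fin k =>
      negMonomial (j + 1) (u i.succ) - negMonomial (j + 1) (u i.castSucc)).det := by
  rw [normalizedVandermonde_eq_det]
  let B : Matrix (Fin (k + 1)) (Fin (k + 1)) ℝ := Matrix.of fun i j =>
    Fin.cases (negMonomial j (u 0))
      (fun i' => negMonomial j (u i'.succ) - negMonomial j (u i'.castSucc)) i
  rw [Matrix.det_eq_of_forall_row_eq_smul_add_pred (B := B) (fun _ => 1) (fun j => by simp [B])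
    (fun i j => by simp [B]), Matrix.det_succ_column_zero, Fin.sum_univ_succ,
    Finset.sum_eq_zero (fun i _ => by simp [B, negMonomial])]
  simp only [B, Matrix.of_apply, Fin.cases_zero, negMonomial, Fin.val_zero, pow_zero,
    Nat.factorial_zero, Nat.cast_one, div_one, one_mul, add_zero]
  congr 1

lemma setOf_interlaced {k : ℕ} (u : Fin (k + 1) → ℝ) :
    {y : Fin k → ℝ | Interlaced u y} =
      Set.univ.pi fun i => Set.Icc (u i.succ) (u i.castSucc) := by
  ext y
  simp only [Interlaced, Set.mem_ofPred_eq, Set.mem_pi, Set.mem_univ, true_implies, Set.mem_Icc]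
  exact ⟨fun h i => ⟨h.2 i (by omega), h.1 i (by omega)⟩,
    fun h => ⟨fun i _ => (h i).2, fun i _ => (h i).1⟩⟩

lemma Interlaced.antitone {k : ℕ} {u : Fin (k + 1) → ℝ} {y : Fin k → ℝ}
    (h : Interlaced u y) : Antitone y := by
  cases k with
  | zero => exact fun i => i.elim0
  | succ k =>
    refine Fin.antitone_iff_succ_le.2 fun i => ?_
    exact (h.1 i.succ (by simp)).trans (h.2 i.castSucc (by simp))

lemma setLIntegral_normalizedVandermonde {k : ℕ} {u : Fin (k + 1) → ℝ} (hu : Antitone u) :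
    ∫⁻ y in {y : Fin k → ℝ | Interlaced u y}, ENNReal.ofReal (normalizedVandermonde y) =
      ENNReal.ofReal (normalizedVandermonde u) := by
  have hint : ∀ i j : Fin k, Integrable (negMonomial j)
      ((volume : Measure ℝ).restrict (Set.Icc (u i.succ) (u i.castSucc))) := fun i j =>
    (continuous_negMonomial j).integrableOn_Icc
  have hmeas : MeasurableSet {y : Fin k → ℝ | Interlaced u y} := by
    rw [setOf_interlaced]
    exact MeasurableSet.univ_pi fun i => measurableSet_Icc
  have hvol : (volume : Measure (Fin k → ℝ)).restrict {y | Interlaced u y} =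
      Measure.pi fun i : Fin k =>
        (volume : Measure ℝ).restrict (Set.Icc (u i.succ) (u i.castSucc)) := by
    rw [setOf_interlaced, volume_pi, Measure.restrict_pi_pi]
  have hnn : 0 ≤ᵐ[(volume : Measure (Fin k → ℝ)).restrict {y | Interlaced u y}]
      normalizedVandermonde :=
    (ae_restrict_iff' hmeas).2 <| .of_forall fun y hy =>
      normalizedVandermonde_nonneg (Interlaced.antitone hy)
  have hfun : (normalizedVandermonde : (Fin k → ℝ) → ℝ) =
      fun y => (Matrix.of fun i j : Fin k => negMonomial j (y i)).det :=
    funext normalizedVandermonde_eq_det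
  rw [← ofReal_integral_eq_lintegral_ofReal _ hnn]
  · rw [hvol, hfun, integral_det hint, normalizedVandermonde_eq_det_sub u]
    congr 3
    ext i j
    exact integral_negMonomial j (hu i.castSucc_le_succ)
  · rw [hvol, hfun]
    exact integrable_det hint

/-- Triangular arrays with top row `u` and rows of lengths `d i`, consecutive rows interlacing. -/
def polytope {m p : ℕ} (d : Fin m → ℕ) (u : Fin p → ℝ) : Set (∀ i, Fin (d i) → ℝ) :=
  {x | (∀ i j : Fin m, (j : ℕ) = i + 1 → Interlaced (x j) (x i)) ∧
    ∀ i : Fin m, (i : ℕ) + 1 = m → Interlaced u (x i)}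

lemma isClosed_setOf_interlaced {X : Type*} [TopologicalSpace X] {p q : ℕ}
    {f : X → Fin p → ℝ} {g : X → Fin q → ℝ} (hf : Continuous f) (hg : Continuous g) :
    IsClosed {x | Interlaced (f x) (g x)} := by
  simp only [Interlaced, Set.ofPred_and, Set.ofPred_forall]
  refine IsClosed.inter ?_ ?_ <;> refine isClosed_iInter fun j => isClosed_iInter fun h => ?_
  · exact isClosed_le (by fun_prop) (by fun_prop)
  · exact isClosed_le (by fun_prop) (by fun_prop)

lemma isClosed_polytope {m p : ℕ} (d : Fin m → ℕ) (u : Fin p → ℝ) :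
    IsClosed (polytope d u) := by
  simp only [polytope, Set.ofPred_and, Set.ofPred_forall]
  refine IsClosed.inter ?_ ?_
  · exact isClosed_iInter fun i => isClosed_iInter fun j => isClosed_iInter fun _ =>
      isClosed_setOf_interlaced (by fun_prop) (by fun_prop)
  · exact isClosed_iInter fun i => isClosed_iInter fun _ =>
      isClosed_setOf_interlaced (by fun_prop) (by fun_prop)

lemma mem_polytope_succ {m p : ℕ} (d : Fin (m + 1) → ℕ) (u : Fin p → ℝ)
    (x : ∀ i, Fin (d i) → ℝ) :
    x ∈ polytope d u ↔ Interlaced u (x (Fin.last m)) ∧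
      (fun i => x ((Fin.last m).succAbove i)) ∈
        polytope (fun i => d ((Fin.last m).succAbove i)) (x (Fin.last m)) := by
  have hval : ∀ i : Fin m, (((Fin.last m).succAbove i : Fin (m + 1)) : ℕ) = i := by simp
  constructor
  · rintro ⟨h1, h2⟩
    refine ⟨h2 _ (by simp), fun i j hij => h1 _ _ ?_, fun i hi => h1 _ _ ?_⟩
    · rw [hval, hval, hij]
    · rw [hval, hi, Fin.val_last]
  · rintro ⟨h0, h1, h2⟩
    refine ⟨fun i j hij => ?_, fun i hi => ?_⟩
    · induction i using Fin.succAboveCases (Fin.last m) with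
      | x => have := j.isLt; simp at hij; omega
      | p i =>
        rw [hval] at hij
        induction j using Fin.succAboveCases (Fin.last m) with
        | x => exact h2 i hij.symm
        | p j => exact h1 i j (by rw [← hij, hval])
    · obtain rfl : i = Fin.last m := Fin.ext (by simpa using hi)
      exact h0

theorem volume_polytope {m p : ℕ} (hp : p = m + 1) (d : Fin m → ℕ)
    (hd : ∀ i, d i = (i : ℕ) + 1) {u : Fin p → ℝ} (hu : Antitone u) :
    volume (polytope d u) = ENNReal.ofReal (normalizedVandermonde u) := by
  induction m generalizing p with
  | zero =>
    subst hp
    have h1 : polytope d u = Set.univ := by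
      ext x
      simp [polytope]
    have h2 : normalizedVandermonde u = 1 := by
      rw [normalizedVandermonde_eq_det]
      simp [negMonomial]
    rw [h1, h2, volume_pi, Measure.pi_univ]
    simp
  | succ m ih =>
    let d' : Fin m → ℕ := fun i => d ((Fin.last m).succAbove i)
    let T : Set ((Fin (d (Fin.last m)) → ℝ) × ∀ i, Fin (d' i) → ℝ) :=
      (MeasurableEquiv.piFinSuccAbove (fun i => Fin (d i) → ℝ) (Fin.last m)).symm ⁻¹'
        polytope d u
    have hT : MeasurableSet T :=
      (MeasurableEquiv.measurable _) (isClosed_polytope d u).measurableSet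
    have hmem : ∀ y z, (y, z) ∈ T ↔ Interlaced u y ∧ z ∈ polytope d' y := by
      intro y z
      refine (mem_polytope_succ d u _).trans ?_
      have h1 : (MeasurableEquiv.piFinSuccAbove (fun i => Fin (d i) → ℝ) (Fin.last m)).symm
          (y, z) (Fin.last m) = y :=
        Fin.insertNth_apply_same (α := fun i => Fin (d i) → ℝ) (Fin.last m) y z
      have h2 : (fun i => (MeasurableEquiv.piFinSuccAbove (fun i => Fin (d i) → ℝ)
          (Fin.last m)).symm (y, z) ((Fin.last m).succAbove i)) = z :=
        funext fun i =>
          Fin.insertNth_apply_succAbove (α := fun i => Fin (d i) → ℝ) (Fin.last m) y z i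
      rw [h1, h2]
    have hvol := (volume_preserving_piFinSuccAbove (fun i => Fin (d i) → ℝ)
      (Fin.last m)).symm.measure_preimage_equiv (polytope d u)
    rw [← hvol]
    change volume T = _
    rw [Measure.volume_eq_prod, Measure.prod_apply hT]
    have hq : p = d (Fin.last m) + 1 := by rw [hp, hd, Fin.val_last]
    have hd' : ∀ i, d' i = (i : ℕ) + 1 := fun i => by simp [d', hd]
    have hlen : d (Fin.last m) = m + 1 := by rw [hd, Fin.val_last]
    subst hq
    have hmeas : MeasurableSet {y : Fin (d (Fin.last m)) → ℝ | Interlaced u y} :=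
      (isClosed_setOf_interlaced continuous_const continuous_id).measurableSet
    rw [← setLIntegral_normalizedVandermonde hu, ← lintegral_indicator hmeas]
    refine lintegral_congr fun y => ?_
    by_cases hy : y ∈ {y | Interlaced u y}
    · have hy' : Interlaced u y := hy
      rw [Set.indicator_of_mem hy, ← ih hlen d' hd' (Interlaced.antitone hy')]
      congr 1
      ext z
      simp [hmem, hy']
    · rw [Set.indicator_of_notMem hy]
      have hy' : ¬ Interlaced u y := hy
      have : Prod.mk y ⁻¹' T = ∅ := by
        ext z
        simp [hmem, hy']
      rw [this, measure_empty]

end GelfandCetlin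

/-- the Lebesgue volume of the Gelfand–Cetlin polytope `GC_a(λ)`
with strictly decreasing top row `λ ∈ ℝ^n` equals
`∏_{i<j} (λ_i - λ_j) / ∏_{k=1}^{n-1} k!`. -/
theorem gelfandCetlin_volume (n : ℕ) (hn : 0 < n) (lam : Fin n → ℝ)
    (hlam : StrictAnti lam) :
    volume {x : ∀ i : Fin (n - 1), Fin ((i : ℕ) + 1) → ℝ |
        (∀ i : Fin (n - 1), ∀ h : (i : ℕ) + 1 < n - 1,
          Interlaced (x ⟨(i : ℕ) + 1, h⟩) (x i)) ∧
        (∀ h : 0 < n - 1, Interlaced lam ((x ⟨n - 2, by omega⟩) ∘ (Fin.cast (by simp; omega) : Fin (n - 1) → Fin _)))} =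
      ENNReal.ofReal
        ((∏ p ∈ Finset.univ.filter fun p : Fin n × Fin n => p.1 < p.2, (lam p.1 - lam p.2)) /
          ∏ k ∈ Finset.range n, (Nat.factorial k : ℝ)) := by
  change _ = ENNReal.ofReal (GelfandCetlin.normalizedVandermonde lam)
  rw [← GelfandCetlin.volume_polytope (m := n - 1) (by omega) (fun i => (i : ℕ) + 1)
      (fun _ => rfl) hlam.antitone]
  congr 1
  ext x
  simp only [Set.mem_ofPred_eq, GelfandCetlin.polytope]
  refine and_congr ⟨fun h i j hij => ?_, fun h i hi => h _ _ rfl⟩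
    ⟨fun h i hi => ?_, fun h h0 => ?_⟩
  · obtain ⟨j, hj⟩ := j
    obtain rfl : j = (i : ℕ) + 1 := hij
    exact h i _
  · obtain ⟨i, hi'⟩ := i
    obtain rfl : i = n - 2 := by simp only at hi; omega
    have h' := h (by omega)
    have hn2 : n - 2 + 1 = n - 1 := by omega
    exact ⟨fun j hj => h'.1 (Fin.cast hn2 j) hj, fun j hj => h'.2 (Fin.cast hn2 j) hj⟩
  · have h' := h ⟨n - 2, by omega⟩ (by simp; omega)
    have hn2 : n - 1 = n - 2 + 1 := by omega
    exact ⟨fun j hj => h'.1 (Fin.cast hn2 j) hj, fun j hj => h'.2 (Fin.cast hn2 j) hj⟩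
end

section
/- Let λ ∈ ℝ^n with λ₁ > ... > λ_n, and let Λ = (Λ^{(1)},...,Λ^{(n-1)}) be uniformly distributed on the Gelfand–Cetlin polytope GC_a(λ). Then the density of Λ^{(n-1)} ∈ ℝ^{n-1} with respect to Lebesgue measure is proportional to ∏_{1≤i<j≤n-1}(μ_i − μ_j) · 1_{λ ⪰ μ}. -/
open MeasureTheory

noncomputable instance {p q : ℕ} (u : Fin p → ℝ) (v : Fin q → ℝ) : Decidable (Interlaced u v) := by
  unfold Interlaced; infer_instance

section Interlacing

theorem interlaced_succ_iff {k : ℕ} (u : Fin (k + 1) → ℝ) (v : Fin k → ℝ) :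
    Interlaced u v ↔ ∀ j, v j ∈ Set.Icc (u j.succ) (u j.castSucc) := by
  constructor
  · rintro ⟨h1, h2⟩ j
    exact ⟨h2 j (by omega), h1 j (by omega)⟩
  · exact fun h => ⟨fun j _ => (h j).2, fun j _ => (h j).1⟩

theorem setOf_interlaced_eq_pi {k : ℕ} (u : Fin (k + 1) → ℝ) :
    {v : Fin k → ℝ | Interlaced u v} =
      Set.univ.pi fun j => Set.Icc (u j.succ) (u j.castSucc) := by
  ext v
  simp only [Set.mem_ofPred_eq, interlaced_succ_iff, Set.mem_univ_pi]

theorem Interlaced.antitone_left {k : ℕ} {u : Fin (k + 1) → ℝ} {v : Fin k → ℝ}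
    (h : Interlaced u v) : Antitone u := by
  rw [interlaced_succ_iff] at h
  exact Fin.antitone_iff_succ_le.2 fun j => (h j).1.trans (h j).2

theorem Interlaced.antitone_right {k : ℕ} {u : Fin (k + 1) → ℝ} {v : Fin k → ℝ}
    (h : Interlaced u v) : Antitone v := by
  have hu := h.antitone_left
  rw [interlaced_succ_iff] at h
  intro i j hij
  rcases hij.eq_or_lt with rfl | hij
  · exact le_rfl
  · exact ((h j).2.trans (hu (by
      rw [Fin.le_def]; simpa using (Nat.succ_le_of_lt (Fin.lt_def.1 hij))))).trans (h i).1

theorem measurableSet_setOf_interlaced (k : ℕ) :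
    MeasurableSet {p : (Fin (k + 1) → ℝ) × (Fin k → ℝ) | Interlaced p.1 p.2} := by
  simp only [interlaced_succ_iff, Set.mem_Icc]
  measurability

theorem measurableSet_setOf_antitone (k : ℕ) :
    MeasurableSet {v : Fin k → ℝ | Antitone v} := by
  unfold Antitone
  measurability

end Interlacing

section Vandermonde

/-- The product of the differences `v i - v j` over `i < j`. -/
def diffProd {k : ℕ} (v : Fin k → ℝ) : ℝ :=
  ∏ p ∈ Finset.univ.filter fun p : Fin k × Fin k => p.1 < p.2, (v p.1 - v p.2)

theorem measurable_diffProd (k : ℕ) : Measurable (diffProd (k := k)) := by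
  unfold diffProd
  fun_prop

theorem continuous_diffProd (k : ℕ) : Continuous (diffProd (k := k)) := by
  unfold diffProd
  fun_prop

theorem diffProd_nonneg {k : ℕ} {v : Fin k → ℝ} (hv : Antitone v) : 0 ≤ diffProd v :=
  Finset.prod_nonneg fun _ hp => sub_nonneg.2 (hv (Finset.mem_filter.1 hp).2.le)

theorem diffProd_pos {k : ℕ} {v : Fin k → ℝ} (hv : StrictAnti v) : 0 < diffProd v :=
  Finset.prod_pos fun _ hp => sub_pos.2 (hv (Finset.mem_filter.1 hp).2)

theorem diffProd_eq_det {k : ℕ} (v : Fin k → ℝ) :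
    diffProd v = (Matrix.vandermonde (-v)).det := by
  rw [diffProd, Matrix.det_vandermonde, Finset.prod_filter, Fintype.prod_prod_type]
  refine Finset.prod_congr rfl fun i _ => ?_
  rw [← Finset.prod_filter]
  refine Finset.prod_congr (by ext; simp) fun j _ => ?_
  simp only [Pi.neg_apply]
  ring

theorem det_vandermonde_eq_det_sub {k : ℕ} (w : Fin (k + 1) → ℝ) :
    (Matrix.vandermonde w).det =
      (Matrix.of fun i j : Fin k =>
        w i.succ ^ ((j : ℕ) + 1) - w i.castSucc ^ ((j : ℕ) + 1)).det := by
  let B : Matrix (Fin (k + 1)) (Fin (k + 1)) ℝ := Matrix.of fun i j =>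
    Fin.cases (w 0 ^ (j : ℕ)) (fun i' => w i'.succ ^ (j : ℕ) - w i'.castSucc ^ (j : ℕ)) i
  have hB : (Matrix.vandermonde w).det = B.det :=
    Matrix.det_eq_of_forall_row_eq_smul_add_pred (fun _ => 1)
      (fun j => by simp [B, Matrix.vandermonde])
      (fun i j => by simp [B, Matrix.vandermonde])
  rw [hB, Matrix.det_succ_column_zero, Fin.sum_univ_succ]
  simp only [B, Matrix.of_apply, Fin.cases_zero, Fin.cases_succ, Fin.val_zero, pow_zero, sub_self,
    mul_zero, zero_mul, Finset.sum_const_zero, add_zero, one_mul]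
  congr 1

/-- Integrating the Vandermonde determinant row by row. -/
theorem setIntegral_diffProd {k : ℕ} {u : Fin (k + 1) → ℝ} (hu : Antitone u) :
    ∫ v in {v : Fin k → ℝ | Interlaced u v}, diffProd v =
      (∏ j : Fin k, ((j : ℝ) + 1)⁻¹) * diffProd u := by
  have hle (i : Fin k) : u i.succ ≤ u i.castSucc := hu (Fin.castSucc_lt_succ).le
  have hint (i j : Fin k) : ∫ t in Set.Icc (u i.succ) (u i.castSucc), (-t) ^ (j : ℕ) =
      ((j : ℝ) + 1)⁻¹ *
        ((-u) i.succ ^ ((j : ℕ) + 1) - (-u) i.castSucc ^ ((j : ℕ) + 1)) := by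
    rw [integral_Icc_eq_integral_Ioc, ← intervalIntegral.integral_of_le (hle i),
      intervalIntegral.integral_comp_neg (fun t => t ^ (j : ℕ)), integral_pow]
    simp only [Pi.neg_apply]
    field_simp
  have hprod (σ : Equiv.Perm (Fin k)) :
      ∫ v in {v : Fin k → ℝ | Interlaced u v}, ∏ i, (-v i) ^ (σ i : ℕ) =
        ∏ i, ∫ t in Set.Icc (u i.succ) (u i.castSucc), (-t) ^ (σ i : ℕ) := by
    rw [setOf_interlaced_eq_pi, volume_pi, Measure.restrict_pi_pi,
      integral_fintype_prod_eq_prod (fun i t => (-t) ^ (σ i : ℕ))]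
  have hcpt : IsCompact {v : Fin k → ℝ | Interlaced u v} := by
    rw [setOf_interlaced_eq_pi]
    exact isCompact_univ_pi fun _ => isCompact_Icc
  rw [diffProd_eq_det u, det_vandermonde_eq_det_sub, ← Matrix.det_mul_row, ← Matrix.det_transpose,
    Matrix.det_apply]
  simp_rw [diffProd_eq_det, ← Matrix.det_transpose (Matrix.vandermonde _), Matrix.det_apply]
  rw [integral_finsetSum]
  · refine Finset.sum_congr rfl fun σ _ => ?_
    simp only [Matrix.transpose_apply, Matrix.vandermonde_apply, Matrix.of_apply, Pi.neg_apply]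
    simp only [Units.smul_def, zsmul_eq_mul]
    rw [integral_const_mul, hprod]
    simp only [hint, Pi.neg_apply]
  · intro σ _
    refine (Continuous.continuousOn ?_).integrableOn_compact hcpt
    simp only [Matrix.transpose_apply, Matrix.vandermonde_apply, Pi.neg_apply]
    fun_prop

theorem setLIntegral_diffProd {k : ℕ} {u : Fin (k + 1) → ℝ} (hu : Antitone u) {C : ℝ}
    (hC : 0 ≤ C) :
    ∫⁻ v in {v : Fin k → ℝ | Interlaced u v}, ENNReal.ofReal (C * diffProd v) =
      ENNReal.ofReal (C * (∏ j : Fin k, ((j : ℝ) + 1)⁻¹) * diffProd u) := by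
  have hcpt : IsCompact {v : Fin k → ℝ | Interlaced u v} := by
    rw [setOf_interlaced_eq_pi]
    exact isCompact_univ_pi fun _ => isCompact_Icc
  rw [← ofReal_integral_eq_lintegral_ofReal, integral_const_mul, setIntegral_diffProd hu, mul_assoc]
  · exact (((continuous_diffProd k).const_smul C).continuousOn).integrableOn_compact hcpt
  · filter_upwards [ae_restrict_mem hcpt.measurableSet] with v hv
    exact mul_nonneg hC (diffProd_nonneg (Interlaced.antitone_right hv))

end Vandermonde

section Snoc

theorem measurePreserving_snoc {m : ℕ} (α : Fin (m + 1) → Type*) [∀ i, MeasureSpace (α i)]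
    [∀ i, SigmaFinite (volume : Measure (α i))] :
    MeasurePreserving
      (fun p : (∀ i : Fin m, α i.castSucc) × α (Fin.last m) => (Fin.snoc p.1 p.2 : ∀ i, α i)) := by
  have hmeas : Measurable
      (fun p : (∀ i : Fin m, α i.castSucc) × α (Fin.last m) => (Fin.snoc p.1 p.2 : ∀ i, α i)) := by
    refine measurable_pi_lambda _ fun i => ?_
    induction i using Fin.lastCases with
    | last => simpa using measurable_snd
    | cast i => simpa [Function.comp_def] using (measurable_pi_apply i).comp measurable_fst
  refine ⟨hmeas, (Measure.pi_eq fun s hs => ?_).symm⟩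
  rw [Measure.map_apply hmeas (MeasurableSet.univ_pi hs)]
  have hpre : (fun p : (∀ i : Fin m, α i.castSucc) × α (Fin.last m) =>
      (Fin.snoc p.1 p.2 : ∀ i, α i)) ⁻¹' Set.univ.pi s =
      (Set.univ.pi fun i : Fin m => s i.castSucc) ×ˢ s (Fin.last m) := by
    ext p
    simp [Set.mem_pi, Fin.forall_fin_succ']
  rw [hpre, Measure.volume_eq_prod, Measure.prod_prod, volume_pi_pi, Fin.prod_univ_castSucc]

end Snoc

section Pattern

/-- Triangular arrays with rows of length `1, …, m + 1` whose consecutive rows interlace. -/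
def gcPattern (m : ℕ) : Set (∀ i : Fin (m + 1), Fin ((i : ℕ) + 1) → ℝ) :=
  {x | ∀ i : Fin (m + 1), ∀ h : (i : ℕ) + 1 < m + 1, Interlaced (x ⟨(i : ℕ) + 1, h⟩) (x i)}

theorem measurableSet_gcPattern (m : ℕ) : MeasurableSet (gcPattern m) := by
  simp only [gcPattern, Set.ofPred_forall]
  refine MeasurableSet.iInter fun i => MeasurableSet.iInter fun h => ?_
  have hpair : Measurable fun x : ∀ i : Fin (m + 1), Fin ((i : ℕ) + 1) → ℝ =>
      (x ⟨(i : ℕ) + 1, h⟩, x i) := (measurable_pi_apply _).prodMk (measurable_pi_apply _)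
  exact hpair (measurableSet_setOf_interlaced ((i : ℕ) + 1))

theorem snoc_mem_gcPattern_iff {m : ℕ} (y : ∀ i : Fin (m + 1), Fin ((i : ℕ) + 1) → ℝ)
    (t : Fin (m + 2) → ℝ) :
    (Fin.snoc (α := fun i : Fin (m + 2) => Fin ((i : ℕ) + 1) → ℝ) y t) ∈ gcPattern (m + 1) ↔
      y ∈ gcPattern m ∧ Interlaced t (y (Fin.last m)) := by
  let z := Fin.snoc (α := fun i : Fin (m + 2) => Fin ((i : ℕ) + 1) → ℝ) y t
  have hz (i : Fin (m + 1)) : z i.castSucc = y i := Fin.snoc_castSucc ..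
  have hzl : z (Fin.last _) = t := Fin.snoc_last ..
  change z ∈ gcPattern (m + 1) ↔ _
  constructor
  · intro h
    refine ⟨fun i hi => ?_, ?_⟩
    · have := h i.castSucc (by simp; omega)
      rw [hz] at this
      rw [← hz ⟨(i : ℕ) + 1, hi⟩]
      exact this
    · have := h (Fin.last m).castSucc (by simp)
      rw [hz] at this
      rw [← hzl]
      exact this
  · rintro ⟨h1, h2⟩ i hi
    induction i using Fin.lastCases with
    | last => simp at hi
    | cast i =>
      rw [hz]
      induction i using Fin.lastCases with
      | last => rw [← hzl] at h2; exact h2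
      | cast i =>
        have := h1 i.castSucc (by simp)
        rw [← hz ⟨_, _⟩] at this
        exact this

/-- The top row of the Lebesgue measure on interlacing arrays has density proportional to the
product of differences. -/
theorem exists_setLIntegral_gcPattern_last (m : ℕ) :
    ∃ C : ℝ, 0 < C ∧ ∀ f : (Fin (m + 1) → ℝ) → ENNReal, Measurable f →
      ∫⁻ x in gcPattern m, f (x (Fin.last m)) =
        ∫⁻ v in {v : Fin (m + 1) → ℝ | Antitone v}, ENNReal.ofReal (C * diffProd v) * f v := by
  induction m with
  | zero =>
    let : Unique (Fin (0 + 1)) := inferInstanceAs (Unique (Fin 1))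
    refine ⟨1, one_pos, fun f hf => ?_⟩
    have h1 : gcPattern 0 = Set.univ := by
      ext x
      simp [gcPattern]
    have h2 : {v : Fin (0 + 1) → ℝ | Antitone v} = Set.univ := by
      ext v
      simpa using Subsingleton.antitone v
    have h3 (v : Fin (0 + 1) → ℝ) : diffProd v = 1 := by
      refine Finset.prod_eq_one fun p hp => ?_
      exact absurd (Finset.mem_filter.1 hp).2 (by rw [Subsingleton.elim p.1 p.2]; exact lt_irrefl _)
    simp only [h1, h2, h3, Measure.restrict_univ, mul_one, ENNReal.ofReal_one, one_mul]
    have hmp : MeasurePreserving fun x : ∀ i : Fin (0 + 1), Fin ((i : ℕ) + 1) → ℝ =>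
        (x (Fin.last 0) : Fin (0 + 1) → ℝ) :=
      volume_preserving_piUnique fun i : Fin (0 + 1) => Fin ((i : ℕ) + 1) → ℝ
    exact hmp.lintegral_comp hf
  | succ m ih =>
    obtain ⟨C, hC, ih⟩ := ih
    refine ⟨C * ∏ j : Fin (m + 1), ((j : ℝ) + 1)⁻¹, by positivity, fun f hf => ?_⟩
    have hS := measurableSet_gcPattern (m + 1)
    have hsnoc := measurePreserving_snoc fun i : Fin (m + 2) => Fin ((i : ℕ) + 1) → ℝ
    have hlast : Measurable fun x : ∀ i : Fin (m + 2), Fin ((i : ℕ) + 1) → ℝ =>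
      x (Fin.last (m + 1)) := measurable_pi_apply _
    have hF : Measurable ((gcPattern (m + 1)).indicator fun x => f (x (Fin.last (m + 1)))) :=
      (hf.comp hlast).indicator hS
    rw [← lintegral_indicator hS, ← hsnoc.lintegral_comp hF, Measure.volume_eq_prod,
      lintegral_prod_symm (fun p => (gcPattern (m + 1)).indicator _ (Fin.snoc p.1 p.2))
        (hF.comp hsnoc.measurable).aemeasurable,
      ← lintegral_indicator (measurableSet_setOf_antitone _)]
    refine lintegral_congr fun (t : Fin (m + 2) → ℝ) => ?_
    have hT : MeasurableSet {v : Fin (m + 1) → ℝ | Interlaced t v} :=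
      measurable_prodMk_left (measurableSet_setOf_interlaced _)
    calc
      _ = ∫⁻ y in gcPattern m,
          {v : Fin (m + 1) → ℝ | Interlaced t v}.indicator (fun _ => f t) (y (Fin.last m)) := by
        rw [← lintegral_indicator (measurableSet_gcPattern m)]
        refine lintegral_congr fun y => ?_
        classical
        simp only [Set.indicator_apply, Set.mem_ofPred_eq, Fin.snoc_last]
        have := snoc_mem_gcPattern_iff y t
        by_cases h1 : y ∈ gcPattern m <;> by_cases h2 : Interlaced t (y (Fin.last m)) <;>
          simp_all
      _ = ∫⁻ v in {v : Fin (m + 1) → ℝ | Interlaced t v},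
          ENNReal.ofReal (C * diffProd v) * f t := by
        rw [ih _ (measurable_const.indicator hT),
          ← lintegral_indicator (measurableSet_setOf_antitone _), ← lintegral_indicator hT]
        refine lintegral_congr fun v => ?_
        by_cases h : Interlaced t v
        · simp [h, h.antitone_right]
        · simp [h]
      _ = _ := by
        rw [lintegral_mul_const _ (by have := measurable_diffProd (m + 1); fun_prop)]
        by_cases ht : Antitone t
        · rw [setLIntegral_diffProd (k := m + 1) ht hC.le]
          simp [ht]
        · have : {v : Fin (m + 1) → ℝ | Interlaced t v} = ∅ :=
            Set.eq_empty_of_forall_notMem fun v hv => ht (Interlaced.antitone_left hv)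
          simp [ht, this]

end Pattern

/-- if `Λ` is uniformly distributed on the Gelfand–Cetlin polytope
`GC_a(λ)` (with `λ₁ > ... > λ_n`), then the law of the row `Λ^{(n-1)}` has a
density with respect to Lebesgue measure on `ℝ^{n-1}` proportional to
`∏_{i<j} (μ_i - μ_j) · 1_{λ ⪰ μ}`. -/
theorem gelfandCetlin_marginal_density (n : ℕ) (hn : 2 ≤ n) (lam : Fin n → ℝ)
    (hlam : StrictAnti lam) :
    ∃ c : ℝ, 0 < c ∧
      Measure.map
        (fun x : ∀ i : Fin (n - 1), Fin ((i : ℕ) + 1) → ℝ =>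
          (x ⟨n - 2, by omega⟩) ∘ (Fin.cast (by simp; omega) : Fin (n - 1) → Fin _))
        ((volume {x : ∀ i : Fin (n - 1), Fin ((i : ℕ) + 1) → ℝ |
            (∀ i : Fin (n - 1), ∀ h : (i : ℕ) + 1 < n - 1,
              Interlaced (x ⟨(i : ℕ) + 1, h⟩) (x i)) ∧
            Interlaced lam
              ((x ⟨n - 2, by omega⟩) ∘ (Fin.cast (by simp; omega) : Fin (n - 1) → Fin _))})⁻¹ •
          volume.restrict {x : ∀ i : Fin (n - 1), Fin ((i : ℕ) + 1) → ℝ |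
            (∀ i : Fin (n - 1), ∀ h : (i : ℕ) + 1 < n - 1,
              Interlaced (x ⟨(i : ℕ) + 1, h⟩) (x i)) ∧
            Interlaced lam
              ((x ⟨n - 2, by omega⟩) ∘ (Fin.cast (by simp; omega) : Fin (n - 1) → Fin _))}) =
      volume.withDensity (fun mu : Fin (n - 1) → ℝ =>
        ENNReal.ofReal (c *
          (∏ p ∈ Finset.univ.filter fun p : Fin (n - 1) × Fin (n - 1) => p.1 < p.2,
            (mu p.1 - mu p.2)) *
          (if Interlaced lam mu then 1 else 0))) := by
  obtain ⟨m, rfl⟩ : ∃ m, n = m + 2 := ⟨n - 2, by omega⟩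
  obtain ⟨C, hC, hlaw⟩ := exists_setLIntegral_gcPattern_last m
  have hT : MeasurableSet {v : Fin (m + 1) → ℝ | Interlaced lam v} :=
    measurable_prodMk_left (measurableSet_setOf_interlaced _)
  have hlast : Measurable fun x : ∀ i : Fin (m + 1), Fin ((i : ℕ) + 1) → ℝ => x (Fin.last m) :=
    measurable_pi_apply _
  have hvol (A : Set (Fin (m + 1) → ℝ)) (hA : MeasurableSet A) :
      volume ((fun x : ∀ i : Fin (m + 1), Fin ((i : ℕ) + 1) → ℝ => x (Fin.last m)) ⁻¹' A ∩
        (gcPattern m ∩ {x | Interlaced lam (x (Fin.last m))})) =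
        ∫⁻ v in A ∩ {v | Interlaced lam v}, ENNReal.ofReal (C * diffProd v) := by
    have h := hlaw ((A ∩ {v | Interlaced lam v}).indicator 1)
      (measurable_one.indicator (hA.inter hT))
    rw [← lintegral_indicator (measurableSet_setOf_antitone _)] at h
    rw [← lintegral_indicator (hA.inter hT)]
    calc
      _ = ∫⁻ x in gcPattern m, (A ∩ {v | Interlaced lam v}).indicator 1 (x (Fin.last m)) := by
        have hmeas := (hlast hA).inter ((measurableSet_gcPattern m).inter (hlast hT))
        refine (lintegral_indicator_one hmeas).symm.trans ?_
        rw [← lintegral_indicator (measurableSet_gcPattern m)]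
        refine lintegral_congr fun x => ?_
        classical
        simp only [Set.indicator_apply, Set.mem_inter_iff, Set.mem_preimage, Set.mem_ofPred_eq,
          Pi.one_apply]
        split_ifs <;> tauto
      _ = _ := by
        rw [h]
        refine lintegral_congr fun v => ?_
        by_cases hv : Interlaced lam v
        · by_cases hvA : v ∈ A <;> simp [hv, hvA, hv.antitone_right]
        · simp [hv]
  have htotal : volume (gcPattern m ∩ {x | Interlaced lam (x (Fin.last m))}) =
      ENNReal.ofReal (C * (∏ j : Fin (m + 1), ((j : ℝ) + 1)⁻¹) * diffProd lam) := by
    rw [← setLIntegral_diffProd hlam.antitone hC.le]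
    simpa using hvol Set.univ MeasurableSet.univ
  have hpos : 0 < C * (∏ j : Fin (m + 1), ((j : ℝ) + 1)⁻¹) * diffProd lam :=
    mul_pos (by positivity) (diffProd_pos hlam)
  generalize C * (∏ j : Fin (m + 1), ((j : ℝ) + 1)⁻¹) * diffProd lam = V at htotal hpos
  refine ⟨V⁻¹ * C, by positivity, ?_⟩
  change Measure.map (fun x : ∀ i : Fin (m + 1), Fin ((i : ℕ) + 1) → ℝ => x (Fin.last m))
    ((volume (gcPattern m ∩ {x | Interlaced lam (x (Fin.last m))}))⁻¹ •
      volume.restrict (gcPattern m ∩ {x | Interlaced lam (x (Fin.last m))})) =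
    volume.withDensity fun v : Fin (m + 1) → ℝ =>
      ENNReal.ofReal (V⁻¹ * C * diffProd v * if Interlaced lam v then 1 else 0)
  refine Measure.ext fun (A : Set (Fin (m + 1) → ℝ)) hA => ?_
  replace hA : @MeasurableSet (Fin (m + 1) → ℝ) _ A := hA
  rw [Measure.map_apply hlast hA, Measure.smul_apply, Measure.restrict_apply (hlast hA), hvol A hA,
    withDensity_apply _ hA, htotal, smul_eq_mul, ← ENNReal.ofReal_inv_of_pos hpos,
    ← lintegral_const_mul _ (by have := measurable_diffProd (m + 1); fun_prop)]
  change _ = ∫⁻ v : Fin (m + 1) → ℝ in A, _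
  rw [← lintegral_indicator hA, ← lintegral_indicator (hA.inter hT)]
  refine lintegral_congr fun v => ?_
  by_cases hvA : v ∈ A <;> by_cases hv : Interlaced lam v
  · simp [hvA, hv, ← ENNReal.ofReal_mul (inv_nonneg.2 hpos.le), mul_assoc]
  all_goals simp [hvA, hv]
end

section
/- For λ ∈ ℝ^n with λ₁ > ... > λ_n > 0, the volume of the symplectic Gelfand–Cetlin polytope GC_c(λ) (arrays x^{(1)},...,x^{(2n)} with x^{(2i)}, x^{(2i-1)} ∈ ℝ₊^i, x^{(k)} ⪰ x^{(k-1)} for all k, and top row x^{(2n)} = λ) is a strictly positive finite number, and equals c_n · ∏_i λ_i · ∏_{i<j}(λ_i² − λ_j²) for some constant c_n > 0 depending only on n. -/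
open MeasureTheory

/-- The symplectic Gelfand–Cetlin polytope `GC_c(λ)`: arrays
`x^{(1)}, ..., x^{(2n-1)}` (row `k` having `⌈k/2⌉` nonnegative entries) with
consecutive rows interlaced and top row `λ = x^{(2n)}` interlacing `x^{(2n-1)}`. -/
def GCc (n : ℕ) (hn : 1 ≤ n) (lam : Fin n → ℝ) :
    Set (∀ k : Fin (2 * n - 1), Fin ((k : ℕ) / 2 + 1) → ℝ) :=
  {x | (∀ k : Fin (2 * n - 1), ∀ j, 0 ≤ x k j) ∧
       (∀ k : Fin (2 * n - 1), ∀ h : (k : ℕ) + 1 < 2 * n - 1,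
         Interlaced (x ⟨(k : ℕ) + 1, h⟩) (x k)) ∧
       Interlaced lam
         ((x ⟨2 * n - 2, by omega⟩) ∘ (Fin.cast (by simp; omega) : Fin n → Fin _))}

/-- Arrays of `m` nonnegative rows, row `k` having `k / 2 + 1` entries, in which consecutive rows
interlace and `u` interlaces the last row. -/
def gcArrays (m : ℕ) {p : ℕ} (u : Fin p → ℝ) : Set (∀ k : Fin m, Fin ((k : ℕ) / 2 + 1) → ℝ) :=
  {x | (∀ k j, 0 ≤ x k j) ∧
    (∀ k : Fin m, ∀ h : (k : ℕ) + 1 < m, Interlaced (x ⟨(k : ℕ) + 1, h⟩) (x k)) ∧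
    ∀ k : Fin m, (k : ℕ) + 1 = m → Interlaced u (x k)}

lemma interlaced_comp_cast {p q q' : ℕ} (u : Fin p → ℝ) (v : Fin q → ℝ) (h : q' = q) :
    Interlaced u (v ∘ Fin.cast h) ↔ Interlaced u v := by
  subst h; rfl

lemma GCc_eq_gcArrays (n : ℕ) (hn : 1 ≤ n) (lam : Fin n → ℝ) :
    GCc n hn lam = gcArrays (2 * n - 1) lam := by
  ext x
  simp only [GCc, gcArrays, Set.mem_ofPred_eq, interlaced_comp_cast]
  refine and_congr_right fun _ => and_congr_right fun _ => ⟨fun h k hk => ?_, fun h => ?_⟩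
  · have e : k = ⟨2 * n - 2, by omega⟩ := Fin.ext (by simp; omega)
    rw [e]
    exact h
  · exact h _ (by simp; omega)

lemma mem_gcArrays_succ {m p : ℕ} {u : Fin p → ℝ}
    {x : ∀ k : Fin (m + 1), Fin ((k : ℕ) / 2 + 1) → ℝ} :
    x ∈ gcArrays (m + 1) u ↔
      ((∀ j, 0 ≤ x (Fin.last m) j) ∧ Interlaced u (x (Fin.last m))) ∧
        (fun k : Fin m => x k.castSucc) ∈ gcArrays m (x (Fin.last m)) := by
  constructor
  · rintro ⟨h0, h1, h2⟩
    refine ⟨⟨h0 _, h2 _ rfl⟩, fun k => h0 k.castSucc, fun k h => h1 k.castSucc (by simp),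
      fun k h => ?_⟩
    have hk : (⟨(k.castSucc : ℕ) + 1, by simp⟩ : Fin (m + 1)) = Fin.last m := Fin.ext h
    have := h1 k.castSucc (by simp)
    rwa [hk] at this
  · rintro ⟨⟨a, b⟩, h0, h1, h2⟩
    refine ⟨fun k => ?_, fun k h => ?_, fun k h => ?_⟩
    · induction k using Fin.lastCases with
      | last => exact a
      | cast k => exact h0 k
    · induction k using Fin.lastCases with
      | last => simp at h
      | cast k =>
        by_cases hk : (k : ℕ) + 1 < m
        · exact h1 k hk
        · have hk' : (k : ℕ) + 1 = m := by omega
          have e : (⟨(k.castSucc : ℕ) + 1, h⟩ : Fin (m + 1)) = Fin.last m := Fin.ext hk'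
          rw [e]
          exact h2 k hk'
    · obtain rfl : k = Fin.last m := Fin.ext (by simpa using h)
      exact b

lemma isClosed_setOf_interlaced {X : Type*} [TopologicalSpace X] {p q : ℕ}
    {a : X → Fin p → ℝ} {b : X → Fin q → ℝ} (ha : Continuous a) (hb : Continuous b) :
    IsClosed {x | Interlaced (a x) (b x)} := by
  simp only [Interlaced, Set.ofPred_and, Set.ofPred_forall, ge_iff_le]
  exact (isClosed_iInter fun j => isClosed_iInter fun h =>
      isClosed_le (by fun_prop) (by fun_prop)).inter
    (isClosed_iInter fun j => isClosed_iInter fun h => isClosed_le (by fun_prop) (by fun_prop))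

lemma isClosed_setOf_mem_gcArrays {m p : ℕ} :
    IsClosed {z : (Fin p → ℝ) × (∀ k : Fin m, Fin ((k : ℕ) / 2 + 1) → ℝ) |
      z.2 ∈ gcArrays m z.1} := by
  have e : {z : (Fin p → ℝ) × (∀ k : Fin m, Fin ((k : ℕ) / 2 + 1) → ℝ) |
      z.2 ∈ gcArrays m z.1} = {z | (∀ k j, 0 ≤ z.2 k j) ∧
      (∀ k : Fin m, ∀ h : (k : ℕ) + 1 < m, Interlaced (z.2 ⟨(k : ℕ) + 1, h⟩) (z.2 k)) ∧
      ∀ k : Fin m, (k : ℕ) + 1 = m → Interlaced z.1 (z.2 k)} := rfl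
  rw [e]
  simp only [Set.ofPred_and, Set.ofPred_forall]
  refine IsClosed.inter (isClosed_iInter fun k => isClosed_iInter fun j =>
    isClosed_le continuous_const (by fun_prop)) (IsClosed.inter ?_ ?_)
  · exact isClosed_iInter fun k => isClosed_iInter fun h =>
      isClosed_setOf_interlaced (by fun_prop) (by fun_prop)
  · exact isClosed_iInter fun k => isClosed_iInter fun h =>
      isClosed_setOf_interlaced (by fun_prop) (by fun_prop)

lemma measurePreserving_last_init {m : ℕ} (β : Fin (m + 1) → Type) [∀ i, MeasureSpace (β i)]
    [∀ i, SigmaFinite (volume : Measure (β i))] :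
    MeasurePreserving (fun x : ∀ i, β i => (x (Fin.last m), fun k : Fin m => x k.castSucc))
      volume volume := by
  have key : ∀ f : Fin m → Fin (m + 1), f = (Fin.last m).succAbove →
      MeasurePreserving (fun x : ∀ i, β i => (x (Fin.last m), fun k : Fin m => x (f k)))
        volume volume := by
    rintro _ rfl
    exact volume_preserving_piFinSuccAbove β (Fin.last m)
  exact key _ Fin.succAbove_last.symm

lemma volume_gcArrays_succ (m : ℕ) {p : ℕ} (u : Fin p → ℝ) :
    volume (gcArrays (m + 1) u) =
      ∫⁻ v in {v : Fin (m / 2 + 1) → ℝ | (∀ j, 0 ≤ v j) ∧ Interlaced u v},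
        volume (gcArrays m v) := by
  set R := {v : Fin (m / 2 + 1) → ℝ | (∀ j, 0 ≤ v j) ∧ Interlaced u v}
  have hR : IsClosed R := by
    simp only [R, Set.ofPred_and, Set.ofPred_forall]
    exact (isClosed_iInter fun j => isClosed_le (by fun_prop) (by fun_prop)).inter
      (isClosed_setOf_interlaced (by fun_prop) (by fun_prop))
  set T := {z : (Fin (m / 2 + 1) → ℝ) × (∀ k : Fin m, Fin ((k : ℕ) / 2 + 1) → ℝ) |
    z.1 ∈ R ∧ z.2 ∈ gcArrays m z.1}
  have hT : MeasurableSet T :=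
    ((hR.preimage continuous_fst).inter isClosed_setOf_mem_gcArrays).measurableSet
  have hpre : gcArrays (m + 1) u = (fun x : ∀ k : Fin (m + 1), Fin ((k : ℕ) / 2 + 1) → ℝ =>
      ((x (Fin.last m), fun k : Fin m => x k.castSucc) :
        (Fin (m / 2 + 1) → ℝ) × (∀ k : Fin m, Fin ((k : ℕ) / 2 + 1) → ℝ))) ⁻¹' T := by
    ext x
    exact mem_gcArrays_succ
  rw [hpre, (measurePreserving_last_init
    fun k : Fin (m + 1) => Fin ((k : ℕ) / 2 + 1) → ℝ).measure_preimage hT.nullMeasurableSet,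
    Measure.volume_eq_prod, Measure.prod_apply hT, ← lintegral_indicator hR.measurableSet]
  refine lintegral_congr fun v => ?_
  by_cases hv : v ∈ R
  · rw [Set.indicator_of_mem hv]
    congr 1
    ext y
    simp [T, hv]
  · rw [Set.indicator_of_notMem hv]
    convert measure_empty (μ := volume)
    ext y
    simp [T, hv]

lemma integral_pi_Icc_det {q : ℕ} {a b : Fin q → ℝ} (hab : a ≤ b) {g G : Fin q → ℝ → ℝ}
    (hg : ∀ j, Continuous (g j)) (hG : ∀ j t, HasDerivAt (G j) (g j t) t) :
    ∫ v in Set.univ.pi fun i => Set.Icc (a i) (b i), (Matrix.of fun i j => g j (v i)).det =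
      (Matrix.of fun i j => G j (b i) - G j (a i)).det := by
  have hint : ∀ σ : Equiv.Perm (Fin q), IntegrableOn (fun v : Fin q → ℝ => ∏ i, g (σ i) (v i))
      (Set.univ.pi fun i => Set.Icc (a i) (b i)) := fun σ =>
    (continuous_finsetProd _ fun i _ => (hg _).comp
      (continuous_apply i)).continuousOn.integrableOn_compact
        (isCompact_univ_pi fun i => isCompact_Icc)
  simp_rw [← Matrix.det_transpose (Matrix.of _), Matrix.det_apply', Matrix.transpose_apply,
    Matrix.of_apply]
  rw [integral_finsetSum _ fun σ _ => (hint σ).const_mul _]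
  refine Finset.sum_congr rfl fun σ _ => ?_
  rw [integral_const_mul, volume_pi, Measure.restrict_pi_pi,
    integral_fintype_prod_eq_prod (f := fun i => g (σ i))]
  congr 1
  refine Finset.prod_congr rfl fun i _ => ?_
  rw [integral_Icc_eq_integral_Ioc, ← intervalIntegral.integral_of_le (hab i),
    intervalIntegral.integral_eq_sub_of_hasDerivAt (fun t _ => hG _ t)
      ((hg _).intervalIntegrable _ _)]

lemma lintegral_pi_Icc_det {q : ℕ} {a b : Fin q → ℝ} (hab : a ≤ b) {g G : Fin q → ℝ → ℝ}
    (hg : ∀ j, Continuous (g j)) (hG : ∀ j t, HasDerivAt (G j) (g j t) t) {c : ℝ} (hc : 0 ≤ c)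
    (hpos : ∀ v : Fin q → ℝ, (∀ i, v i ∈ Set.Icc (a i) (b i)) →
      0 ≤ (Matrix.of fun i j => g j (v i)).det) :
    ∫⁻ v in Set.univ.pi fun i => Set.Icc (a i) (b i),
        ENNReal.ofReal (c * (Matrix.of fun i j => g j (v i)).det) =
      ENNReal.ofReal (c * (Matrix.of fun i j => G j (b i) - G j (a i)).det) := by
  have hS : MeasurableSet (Set.univ.pi fun i => Set.Icc (a i) (b i)) :=
    MeasurableSet.univ_pi fun i => measurableSet_Icc
  rw [← integral_pi_Icc_det hab hg hG, ← integral_const_mul, ofReal_integral_eq_lintegral_ofReal]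
  · refine ContinuousOn.integrableOn_compact (isCompact_univ_pi fun i => isCompact_Icc)
      (Continuous.continuousOn ?_)
    refine continuous_const.mul (Continuous.matrix_det ?_)
    exact continuous_matrix fun i j => (hg j).comp (continuous_apply i)
  · refine (ae_restrict_iff' hS).2 (Filter.Eventually.of_forall fun v hv => ?_)
    exact mul_nonneg hc (hpos v fun i => hv i trivial)

lemma det_succ_sub_castSucc {R : Type*} [CommRing R] {q : ℕ} (K : Fin (q + 1) → Fin q → R) :
    (Matrix.of fun i j : Fin q => K i.succ j - K i.castSucc j).det =
      (Matrix.of fun i : Fin (q + 1) => (Fin.cons 1 (K i) : Fin (q + 1) → R)).det := by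
  set B : Matrix (Fin (q + 1)) (Fin (q + 1)) R :=
    Matrix.of (Fin.cons (Fin.cons 1 (K 0)) fun i => Fin.cons 0 fun j => K i.succ j - K i.castSucc j)
  rw [Matrix.det_eq_of_forall_row_eq_smul_add_pred (B := B) (fun _ => 1),
    Matrix.det_succ_column_zero, Fin.sum_univ_succ]
  · simp [B, Matrix.submatrix]
  · intro j; rfl
  · intro i j
    refine Fin.cases ?_ (fun j => ?_) j <;> simp [B]

/-- The Vandermonde product `∏_{i<j} (u_i² - u_j²)`. -/
def sqVandermonde {p : ℕ} (u : Fin p → ℝ) : ℝ :=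
  (Matrix.vandermonde fun i => -u i ^ 2).det

lemma sqVandermonde_eq_prod {p : ℕ} (u : Fin p → ℝ) :
    sqVandermonde u = ∏ i, ∏ j ∈ Finset.Ioi i, (u i ^ 2 - u j ^ 2) := by
  rw [sqVandermonde, Matrix.det_vandermonde]
  exact Finset.prod_congr rfl fun i _ => Finset.prod_congr rfl fun j _ => by ring

lemma sqVandermonde_nonneg {p : ℕ} {u : Fin p → ℝ} (hu : Antitone u) (h0 : ∀ i, 0 ≤ u i) :
    0 ≤ sqVandermonde u := by
  rw [sqVandermonde_eq_prod]
  refine Finset.prod_nonneg fun i _ => Finset.prod_nonneg fun j hj => sub_nonneg.2 ?_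
  exact pow_le_pow_left₀ (h0 j) (hu (Finset.mem_Ioi.1 hj).le) 2

lemma det_oddPow {p : ℕ} (u : Fin p → ℝ) :
    (Matrix.of fun i j : Fin p => u i * (-u i ^ 2) ^ (j : ℕ)).det =
      (∏ i, u i) * sqVandermonde u :=
  Matrix.det_mul_column u (Matrix.vandermonde fun i => -u i ^ 2)

lemma hasDerivAt_evenPow (k : ℕ) (t : ℝ) :
    HasDerivAt (fun t : ℝ => -(1 / (2 * (k + 1) : ℝ) * (-t ^ 2) ^ (k + 1)))
      (t * (-t ^ 2) ^ k) t := by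
  refine ((((hasDerivAt_pow 2 t).fun_neg.fun_pow (k + 1)).const_mul
    (1 / (2 * (k + 1) : ℝ))).fun_neg).congr_deriv ?_
  have : (k + 1 : ℝ) ≠ 0 := by positivity
  push_cast
  field_simp

lemma hasDerivAt_oddPow (k : ℕ) (t : ℝ) :
    HasDerivAt (fun t : ℝ => 1 / (2 * k + 1 : ℝ) * (t * (-t ^ 2) ^ k))
      ((-t ^ 2) ^ k) t := by
  have e : ∀ t : ℝ, 1 / (2 * k + 1 : ℝ) * (t * (-t ^ 2) ^ k) =
      1 / (2 * k + 1 : ℝ) * (-1) ^ k * t ^ (2 * k + 1) := fun t => by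
    rw [neg_pow, ← pow_mul]; ring
  simp_rw [e]
  refine ((hasDerivAt_pow (2 * k + 1) t).const_mul
    (1 / (2 * k + 1 : ℝ) * (-1) ^ k)).congr_deriv ?_
  have : (2 * k + 1 : ℝ) ≠ 0 := by positivity
  rw [neg_pow (t ^ 2), ← pow_mul]
  push_cast
  field_simp

lemma setOf_interlaced_succ {q : ℕ} {u : Fin (q + 1) → ℝ} (h0 : ∀ i, 0 ≤ u i) :
    {v : Fin q → ℝ | (∀ j, 0 ≤ v j) ∧ Interlaced u v} =
      Set.univ.pi fun i : Fin q => Set.Icc (u i.succ) (u i.castSucc) := by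
  ext v
  simp only [Set.mem_ofPred_eq, Set.mem_univ_pi, Set.mem_Icc, Interlaced]
  constructor
  · rintro ⟨-, h1, h2⟩ i
    exact ⟨h2 i (by simp), h1 i (by omega)⟩
  · exact fun h => ⟨fun j => (h0 _).trans (h j).1, fun j _ => (h j).2, fun j _ => (h j).1⟩

lemma setOf_interlaced_self {q : ℕ} (u : Fin q → ℝ) :
    {v : Fin q → ℝ | (∀ j, 0 ≤ v j) ∧ Interlaced u v} =
      Set.univ.pi fun i : Fin q => Set.Icc ((Fin.snoc u 0 : Fin (q + 1) → ℝ) i.succ)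
        ((Fin.snoc u 0 : Fin (q + 1) → ℝ) i.castSucc) := by
  ext v
  simp only [Set.mem_ofPred_eq, Set.mem_univ_pi, Set.mem_Icc, Interlaced, Fin.snoc_castSucc]
  have hlt : ∀ (i : Fin q) (h : (i : ℕ) + 1 < q),
      (Fin.snoc u 0 : Fin (q + 1) → ℝ) i.succ = u ⟨i + 1, h⟩ := fun i h =>
    Fin.snoc_castSucc (α := fun _ => ℝ) 0 u ⟨i + 1, h⟩
  have hlast : ∀ i : Fin q, ¬ (i : ℕ) + 1 < q →
      (Fin.snoc u 0 : Fin (q + 1) → ℝ) i.succ = 0 := fun i h => by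
    have e : i.succ = Fin.last q := Fin.ext (by simp; omega)
    rw [e, Fin.snoc_last]
  constructor
  · rintro ⟨h0, h1, h2⟩ i
    refine ⟨?_, h1 i i.2⟩
    by_cases h : (i : ℕ) + 1 < q
    · rw [hlt i h]; exact h2 i h
    · rw [hlast i h]; exact h0 i
  · refine fun hv => ⟨?_, fun j _ => (hv j).2, fun j h => hlt j h ▸ (hv j).1⟩
    suffices H : ∀ k (j : Fin q), q ≤ j + k → 0 ≤ v j from fun j => H q j (by omega)
    intro k
    induction k with
    | zero => intro j hj; omega
    | succ k ih =>
      intro j hj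
      by_cases h : (j : ℕ) + 1 < q
      · refine (ih ⟨j + 1, h⟩ (by simp; omega)).trans (((hv ⟨j + 1, h⟩).2).trans ?_)
        rw [← hlt j h]
        exact (hv j).1
      · exact hlast j h ▸ (hv j).1

lemma antitone_snoc_zero {q : ℕ} {u : Fin q → ℝ} (hu : Antitone u) (h0 : ∀ i, 0 ≤ u i) :
    Antitone (Fin.snoc u 0 : Fin (q + 1) → ℝ) := by
  intro i j hij
  induction j using Fin.lastCases with
  | last =>
    induction i using Fin.lastCases with
    | last => rfl
    | cast i => simpa using h0 i
  | cast j =>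
    induction i using Fin.lastCases with
    | last => exact absurd hij (by simp [Fin.le_def])
    | cast i => simpa using hu (by simpa using hij)

lemma antitone_of_mem_Icc {q : ℕ} {w : Fin (q + 1) → ℝ} (hw : Antitone w) {v : Fin q → ℝ}
    (hv : ∀ i, v i ∈ Set.Icc (w i.succ) (w i.castSucc)) : Antitone v := by
  intro i j hij
  rcases hij.eq_or_lt with rfl | h
  · rfl
  · exact (hv j).2.trans ((hw (Fin.le_def.2 (by simpa using h))).trans (hv i).1)

lemma det_castSucc_sub_succ_evenPow {q : ℕ} (w : Fin (q + 1) → ℝ) :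
    (Matrix.of fun i j : Fin q =>
      -(1 / (2 * ((j : ℕ) + 1) : ℝ) * (-w i.castSucc ^ 2) ^ (j + 1 : ℕ)) -
      -(1 / (2 * ((j : ℕ) + 1) : ℝ) * (-w i.succ ^ 2) ^ (j + 1 : ℕ))).det =
      (∏ j : Fin q, 1 / (2 * ((j : ℕ) + 1) : ℝ)) * sqVandermonde w := by
  have h := det_succ_sub_castSucc fun (i : Fin (q + 1)) (j : Fin q) =>
    1 / (2 * ((j : ℕ) + 1) : ℝ) * (-w i ^ 2) ^ (j + 1 : ℕ)
  have h2 := Matrix.det_mul_row (Fin.cons 1 fun j : Fin q => 1 / (2 * ((j : ℕ) + 1) : ℝ))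
    (Matrix.vandermonde fun i => -w i ^ 2)
  rw [Fin.prod_cons, one_mul] at h2
  rw [sqVandermonde, ← h2]
  convert h using 2
  · ext i j
    simp only [Matrix.of_apply]
    ring
  · ext i j
    refine Fin.cases ?_ (fun j => ?_) j <;> simp [Matrix.vandermonde]

lemma det_castSucc_sub_succ_of_last_eq_zero {R : Type*} [CommRing R] {q : ℕ}
    (F : Fin (q + 1) → Fin q → R) (hF : F (Fin.last q) = 0) :
    (Matrix.of fun i j : Fin q => F i.castSucc j - F i.succ j).det =
      (Matrix.of fun i : Fin q => F i.castSucc).det := by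
  have h := det_succ_sub_castSucc (-F)
  rw [Matrix.det_succ_row _ (Fin.last q), Fin.sum_univ_succ] at h
  have e : (Matrix.of fun i : Fin (q + 1) => (Fin.cons 1 ((-F) i) : Fin (q + 1) → R)).submatrix
      (Fin.last q).succAbove (0 : Fin (q + 1)).succAbove =
        -(Matrix.of fun i : Fin q => F i.castSucc) := by
    ext i j
    simp
  rw [e, Matrix.det_neg] at h
  simp only [Matrix.of_apply, Pi.neg_apply, hF, Fin.cons_succ, Fin.cons_zero, Pi.zero_apply,
    neg_zero, mul_zero, zero_mul, Finset.sum_const_zero, add_zero, Fin.val_last, Fin.val_zero,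
    mul_one, Fintype.card_fin, ← mul_assoc, ← pow_add, neg_sub_neg] at h
  rw [h, Even.neg_one_pow ⟨q, rfl⟩, one_mul]

lemma det_castSucc_sub_succ_oddPow {q : ℕ} (u : Fin q → ℝ) {w : Fin (q + 1) → ℝ}
    (hw : w = Fin.snoc u 0) :
    (Matrix.of fun i j : Fin q =>
      1 / (2 * (j : ℕ) + 1 : ℝ) * (w i.castSucc * (-w i.castSucc ^ 2) ^ (j : ℕ)) -
        1 / (2 * (j : ℕ) + 1 : ℝ) * (w i.succ * (-w i.succ ^ 2) ^ (j : ℕ))).det =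
      (∏ j : Fin q, 1 / (2 * (j : ℕ) + 1 : ℝ)) * ((∏ i, u i) * sqVandermonde u) := by
  rw [det_castSucc_sub_succ_of_last_eq_zero (fun (i : Fin (q + 1)) (j : Fin q) =>
      1 / (2 * (j : ℕ) + 1 : ℝ) * (w i * (-w i ^ 2) ^ (j : ℕ))) (by ext; simp [hw]),
    ← det_oddPow, ← Matrix.det_mul_row]
  simp [hw]

lemma exists_volume_gcArrays (m : ℕ) : ∃ c : ℝ, 0 < c ∧ ∀ (p : ℕ) (_ : p = m / 2 + 1)
    (u : Fin p → ℝ), Antitone u → (∀ i, 0 ≤ u i) → volume (gcArrays m u) =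
      ENNReal.ofReal (c * ((if Even m then 1 else ∏ i, u i) * sqVandermonde u)) := by
  induction m with
  | zero =>
    refine ⟨1, one_pos, ?_⟩
    rintro _ rfl u - -
    have e : gcArrays 0 u = Set.univ :=
      Set.eq_univ_of_forall fun x => ⟨fun k => k.elim0, fun k => k.elim0, fun k => k.elim0⟩
    rw [e, volume_pi, ← Set.pi_univ Set.univ, Measure.pi_pi]
    have hdet : sqVandermonde u = 1 :=
      (Matrix.det_fin_one (Matrix.vandermonde fun i => -u i ^ 2)).trans (pow_zero _)
    simp [hdet]
  | succ m ih =>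
    obtain ⟨c, hc, ih⟩ := ih
    by_cases hm : Even m
    · refine ⟨c * ∏ j : Fin (m / 2 + 1), 1 / (2 * (j : ℕ) + 1 : ℝ), by positivity, ?_⟩
      intro p hp u hu h0
      obtain rfl : p = m / 2 + 1 := by obtain ⟨k, rfl⟩ := hm; omega
      obtain ⟨w, hw⟩ : ∃ w : Fin (m / 2 + 1 + 1) → ℝ, w = Fin.snoc u 0 := ⟨_, rfl⟩
      have hwa : Antitone w := hw ▸ antitone_snoc_zero hu h0
      have hw0 : ∀ i, 0 ≤ w i := fun i => by
        have := hwa (Fin.le_last i)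
        rwa [hw, Fin.snoc_last, ← hw] at this
      rw [volume_gcArrays_succ, setOf_interlaced_self, ← hw,
        setLIntegral_congr_fun (g := fun v => ENNReal.ofReal
          (c * (Matrix.of fun i j : Fin (m / 2 + 1) => (-v i ^ 2) ^ (j : ℕ)).det))
          (MeasurableSet.univ_pi fun i => measurableSet_Icc),
        lintegral_pi_Icc_det (fun i => hwa (Fin.castSucc_le_succ i)) (fun j => by fun_prop)
          (fun j => hasDerivAt_oddPow j) hc.le, det_castSucc_sub_succ_oddPow u hw]
      · simp [Nat.even_add_one, hm, mul_assoc]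
      · exact fun v hv => sqVandermonde_nonneg (antitone_of_mem_Icc hwa hv)
          fun i => (hw0 _).trans (hv i).1
      · intro v hv
        have hv' := fun i => hv i trivial
        simp only
        rw [ih _ rfl v (antitone_of_mem_Icc hwa hv') fun i => (hw0 _).trans (hv' i).1,
          if_pos hm, one_mul]
        rfl
    · refine ⟨c * ∏ j : Fin (m / 2 + 1), 1 / (2 * ((j : ℕ) + 1) : ℝ), by positivity, ?_⟩
      intro p hp u hu h0
      obtain rfl : p = m / 2 + 1 + 1 := by
        obtain ⟨k, rfl⟩ := Nat.not_even_iff_odd.1 hm; omega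
      rw [volume_gcArrays_succ, setOf_interlaced_succ h0,
        setLIntegral_congr_fun (g := fun v => ENNReal.ofReal
          (c * (Matrix.of fun i j : Fin (m / 2 + 1) => v i * (-v i ^ 2) ^ (j : ℕ)).det))
          (MeasurableSet.univ_pi fun i => measurableSet_Icc),
        lintegral_pi_Icc_det (g := fun j t => t * (-t ^ 2) ^ (j : ℕ))
          (fun i => hu (Fin.castSucc_le_succ i)) (fun j => by fun_prop)
          (fun j => hasDerivAt_evenPow j) hc.le, det_castSucc_sub_succ_evenPow u]
      · simp [Nat.even_add_one, hm, mul_assoc]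
      · intro v hv
        have hv0 : ∀ i, 0 ≤ v i := fun i => (h0 _).trans (hv i).1
        rw [det_oddPow]
        exact mul_nonneg (Finset.prod_nonneg fun i _ => hv0 i)
          (sqVandermonde_nonneg (antitone_of_mem_Icc hu hv) hv0)
      · intro v hv
        have hv' := fun i => hv i trivial
        simp only
        rw [ih _ rfl v (antitone_of_mem_Icc hu hv') fun i => (h0 _).trans (hv' i).1,
          if_neg hm, det_oddPow]

/-- for `λ₁ > ... > λ_n > 0` the volume of `GC_c(λ)` is strictly
positive, finite, and equal to `c_n · ∏_i λ_i · ∏_{i<j} (λ_i² - λ_j²)` for a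
constant `c_n > 0` depending only on `n`. -/
theorem gelfandCetlin_symplectic_volume (n : ℕ) (hn : 1 ≤ n) :
    ∃ c : ℝ, 0 < c ∧
      ∀ lam : Fin n → ℝ, StrictAnti lam → (∀ i, 0 < lam i) →
        0 < volume (GCc n hn lam) ∧ volume (GCc n hn lam) < ⊤ ∧
        volume (GCc n hn lam) =
          ENNReal.ofReal (c * (∏ i, lam i) *
            ∏ p ∈ Finset.univ.filter fun p : Fin n × Fin n => p.1 < p.2,
              (lam p.1 ^ 2 - lam p.2 ^ 2)) := by
  obtain ⟨c, hc, h⟩ := exists_volume_gcArrays (2 * n - 1)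
  refine ⟨c, hc, fun lam hlam hpos => ?_⟩
  have hodd : ¬ Even (2 * n - 1) := by
    rw [Nat.not_even_iff_odd]
    exact ⟨n - 1, by omega⟩
  have hprod : sqVandermonde lam = ∏ p ∈ Finset.univ.filter fun p : Fin n × Fin n => p.1 < p.2,
      (lam p.1 ^ 2 - lam p.2 ^ 2) := by
    rw [sqVandermonde_eq_prod, Finset.prod_filter, Fintype.prod_prod_type]
    refine Finset.prod_congr rfl fun i _ => ?_
    rw [← Finset.prod_filter]
    exact Finset.prod_congr (by ext; simp) fun _ _ => rfl
  have hvol := h n (by omega) lam hlam.antitone fun i => (hpos i).le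
  rw [if_neg hodd, hprod, ← GCc_eq_gcArrays n hn, ← mul_assoc] at hvol
  refine ⟨?_, ?_, hvol⟩
  · rw [hvol, ENNReal.ofReal_pos]
    refine mul_pos (mul_pos hc (Finset.prod_pos fun i _ => hpos i)) (Finset.prod_pos fun p hp => ?_)
    exact sub_pos.2 (pow_lt_pow_left₀ (hlam (Finset.mem_filter.1 hp).2) (hpos _).le two_ne_zero)
  · rw [hvol]
    exact ENNReal.ofReal_lt_top
end
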